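/- Define ĥam(𝔥,ω) := {(v,ξ) ∈ V_ω × ham(𝔥,ω) : i_ξω = d_𝔥v}. Then: (a) the bracket [(v₁,ξ₁),(v₂,ξ₂)] := (ξ₁·v₂ − ξ₂·v₁ + ω(ξ₁,ξ₂), [ξ₁,ξ₂]) makes V_ω × sp(𝔥,ω) into a Lie algebra (the abelian extension V_ω ⋊_ω sp(𝔥,ω)); (b) for (v₁,ξ₁),(v₂,ξ₂) ∈ ĥam(𝔥,ω) one has ξ₁·v₂ = −ξ₂·v₁ = −ω(ξ₁,ξ₂), so that on ĥam(𝔥,ω) this bracket equals ({v₁,v₂},[ξ₁,ξ₂]) = (−ω(ξ₁,ξ₂),[ξ₁,ξ₂]); (c) ĥam(𝔥,ω) is a Lie subalgebra of V_ω ⋊_ω sp(𝔥,ω), and it is likewise a Lie subalgebra of V_ω × sp(𝔥,ω) endowed with the central-extension bracket [(v₁,ξ₁),(v₂,ξ₂)] := (−ω(ξ₁,ξ₂),[ξ₁,ξ₂]). -/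

import Mathlib

/-!  Abstract hamiltonian setting: basic definitions.

`V` is an `𝔥`-module via the bilinear map `act`.  For `v : V`, the
1-cochain `d_𝔥 v` is the map `ξ ↦ act ξ v`, and for `ω` a 2-cochain,
`i_ξ ω = ω ξ`.  -/

variable {k : Type*} [Field k] [CharZero k]
variable {H : Type*} [LieRing H] [LieAlgebra k H]
variable {V : Type*} [AddCommGroup V] [Module k V]

/-- The Lie derivative `(L_ξ ω)(η, ζ)` of a 2-cochain `ω`. -/
def lieD (act : H →ₗ[k] V →ₗ[k] V) (ω : H →ₗ[k] H →ₗ[k] V) (ξ η ζ : H) : V :=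
  act ξ (ω η ζ) - ω ⁅ξ, η⁆ ζ - ω η ⁅ξ, ζ⁆

/-- The Chevalley–Eilenberg differential `(d_𝔥 ω)(ξ₁,ξ₂,ξ₃)` of a 2-cochain. -/
def d2 (act : H →ₗ[k] V →ₗ[k] V) (ω : H →ₗ[k] H →ₗ[k] V) (ξ₁ ξ₂ ξ₃ : H) : V :=
  act ξ₁ (ω ξ₂ ξ₃) - act ξ₂ (ω ξ₁ ξ₃) + act ξ₃ (ω ξ₁ ξ₂)
    - ω ⁅ξ₁, ξ₂⁆ ξ₃ + ω ⁅ξ₁, ξ₃⁆ ξ₂ - ω ⁅ξ₂, ξ₃⁆ ξ₁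

/-- The Chevalley–Eilenberg differential `(d_𝔥 α)(ξ,η)` of a 1-cochain. -/
def d1 (act : H →ₗ[k] V →ₗ[k] V) (α : H →ₗ[k] V) (ξ η : H) : V :=
  act ξ (α η) - act η (α ξ) - α ⁅ξ, η⁆

/-- The symplectic elements `sp(𝔥,ω) = {ξ : L_ξ ω = 0 ∧ i_ξ (d_𝔥 ω) = 0}`. -/
def spSet (act : H →ₗ[k] V →ₗ[k] V) (ω : H →ₗ[k] H →ₗ[k] V) : Set H :=
  {ξ | (∀ η ζ, lieD act ω ξ η ζ = 0) ∧ ∀ η ζ, d2 act ω ξ η ζ = 0}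

/-- The hamiltonian elements `ham(𝔥,ω) = {ξ ∈ sp(𝔥,ω) : ∃ v, i_ξ ω = d_𝔥 v}`. -/
def hamSet (act : H →ₗ[k] V →ₗ[k] V) (ω : H →ₗ[k] H →ₗ[k] V) : Set H :=
  {ξ | ξ ∈ spSet act ω ∧ ∃ v : V, ∀ η, ω ξ η = act η v}

/-- The admissible vectors `V_ω = {v : ∃ ξ ∈ ham(𝔥,ω), d_𝔥 v = i_ξ ω}`. -/
def admSet (act : H →ₗ[k] V →ₗ[k] V) (ω : H →ₗ[k] H →ₗ[k] V) : Set V :=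
  {v | ∃ ξ ∈ hamSet act ω, ∀ η, act η v = ω ξ η}

/-- The radical `rad(ω, d_𝔥 ω) = {ξ : i_ξ ω = 0 ∧ i_ξ (d_𝔥 ω) = 0}`. -/
def radSet (act : H →ₗ[k] V →ₗ[k] V) (ω : H →ₗ[k] H →ₗ[k] V) : Set H :=
  {ξ | (∀ η, ω ξ η = 0) ∧ ∀ η ζ, d2 act ω ξ η ζ = 0}

/-- The invariant vectors `V^𝔥 = {v : ∀ ξ, ξ · v = 0}`. -/
def invSet (act : H →ₗ[k] V →ₗ[k] V) : Set V := {v | ∀ ξ, act ξ v = 0}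

/-- The bracket of the abelian extension `V_ω ⋊_ω sp(𝔥,ω)`. -/
def brAb (act : H →ₗ[k] V →ₗ[k] V) (ω : H →ₗ[k] H →ₗ[k] V) (p q : V × H) :
    V × H :=
  (act p.2 q.1 - act q.2 p.1 + ω p.2 q.2, ⁅p.2, q.2⁆)

/-- The bracket of the central extension `V_ω ×_{−ω₀} sp(𝔥,ω)`. -/
def brCen (ω : H →ₗ[k] H →ₗ[k] V) (p q : V × H) : V × H :=
  (-ω p.2 q.2, ⁅p.2, q.2⁆)

/-- The central extension `ĥam(𝔥,ω) = {(v,ξ) ∈ V_ω × ham(𝔥,ω) : i_ξ ω = d_𝔥 v}`. -/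
def hamHat (act : H →ₗ[k] V →ₗ[k] V) (ω : H →ₗ[k] H →ₗ[k] V) : Set (V × H) :=
  {p | p.1 ∈ admSet act ω ∧ p.2 ∈ hamSet act ω ∧ ∀ η, ω p.2 η = act η p.1}

section helpers
theorem aux_skew (ω : H →ₗ[k] H →ₗ[k] V) (h : ∀ ξ, ω ξ ξ = 0) (a b : H) :
    ω a b = - ω b a := by
  have := h (a + b)
  simp only [map_add, LinearMap.add_apply, h, zero_add, add_zero] at this
  exact eq_neg_of_add_eq_zero_right this

theorem aux_sp_lie (act : H →ₗ[k] V →ₗ[k] V)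
    (hact : ∀ (ξ η : H) (v : V), act ⁅ξ, η⁆ v = act ξ (act η v) - act η (act ξ v))
    (ω : H →ₗ[k] H →ₗ[k] V) (ξ η : H) (hξ : ξ ∈ spSet act ω) (hη : η ∈ spSet act ω) :
    ⁅ξ, η⁆ ∈ spSet act ω := by
  obtain ⟨h1, h2⟩ := hξ
  obtain ⟨g1, g2⟩ := hη
  refine ⟨fun a b => ?_, fun a b => ?_⟩
  · have e : lieD act ω ⁅ξ, η⁆ a b =
        (act ξ (lieD act ω η a b) - lieD act ω η ⁅ξ, a⁆ b - lieD act ω η a ⁅ξ, b⁆)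
        - (act η (lieD act ω ξ a b) - lieD act ω ξ ⁅η, a⁆ b - lieD act ω ξ a ⁅η, b⁆) := by
      simp only [lieD, hact, lie_lie, map_sub, LinearMap.sub_apply]
      abel
    rw [e]; simp [h1, g1]
  · have e : d2 act ω ⁅ξ, η⁆ a b =
        act ξ (d2 act ω η a b) - d2 act ω η ⁅ξ, a⁆ b - d2 act ω η a ⁅ξ, b⁆
        - (act η (lieD act ω ξ a b) - act a (lieD act ω ξ η b) + act b (lieD act ω ξ η a)
          - lieD act ω ξ ⁅η, a⁆ b + lieD act ω ξ ⁅η, b⁆ a - lieD act ω ξ ⁅a, b⁆ η) := by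
      simp only [lieD, d2, hact, lie_lie, map_sub, map_add, LinearMap.sub_apply]
      abel
    rw [e]; simp [h1, g2]

/-- For symplectic `ξ, η`: `d(ω(η,ξ)) = i_[ξ,η] ω`. -/
theorem aux_omega (act : H →ₗ[k] V →ₗ[k] V)
    (ω : H →ₗ[k] H →ₗ[k] V) (hωalt : ∀ ξ, ω ξ ξ = 0)
    (ξ η : H) (hξ : ξ ∈ spSet act ω) (hη : η ∈ spSet act ω) (ζ : H) :
    ω ⁅ξ, η⁆ ζ = act ζ (-ω ξ η) := by
  have e1 := hξ.1 η ζ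
  have e2 := hη.1 ξ ζ
  have e3 := hξ.2 η ζ
  simp only [lieD, d2] at e1 e2 e3
  rw [aux_skew ω hωalt ξ ⁅η, ζ⁆, ← lie_skew η ξ, map_neg, LinearMap.neg_apply] at e2
  rw [aux_skew ω hωalt η ⁅ξ, ζ⁆] at e1
  rw [map_neg]
  rw [← sub_eq_zero]
  have : ω ⁅ξ, η⁆ ζ - -act ζ (ω ξ η) =
    (act ξ (ω η ζ) - act η (ω ξ ζ) + act ζ (ω ξ η)
      - ω ⁅ξ, η⁆ ζ + ω ⁅ξ, ζ⁆ η - ω ⁅η, ζ⁆ ξ)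
    - (act ξ (ω η ζ) - ω ⁅ξ, η⁆ ζ - -ω ⁅ξ, ζ⁆ η)
    + (act η (ω ξ ζ) - -ω ⁅ξ, η⁆ ζ - -ω ⁅η, ζ⁆ ξ) := by abel
  rw [this, e1, e2, e3]; simp

theorem aux_sp_add (act : H →ₗ[k] V →ₗ[k] V)
    (ω : H →ₗ[k] H →ₗ[k] V) (ξ η : H) (hξ : ξ ∈ spSet act ω) (hη : η ∈ spSet act ω) :
    ξ + η ∈ spSet act ω := by
  refine ⟨fun a b => ?_, fun a b => ?_⟩
  · have : lieD act ω (ξ + η) a b = lieD act ω ξ a b + lieD act ω η a b := by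
      simp only [lieD, map_add, LinearMap.add_apply, add_lie]; abel
    rw [this, hξ.1, hη.1, add_zero]
  · have : d2 act ω (ξ + η) a b = d2 act ω ξ a b + d2 act ω η a b := by
      simp only [d2, map_add, LinearMap.add_apply, add_lie]; abel
    rw [this, hξ.2, hη.2, add_zero]

theorem aux_sp_smul (act : H →ₗ[k] V →ₗ[k] V)
    (ω : H →ₗ[k] H →ₗ[k] V) (c : k) (ξ : H) (hξ : ξ ∈ spSet act ω) :
    c • ξ ∈ spSet act ω := by
  refine ⟨fun a b => ?_, fun a b => ?_⟩
  · have : lieD act ω (c • ξ) a b = c • lieD act ω ξ a b := by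
      simp only [lieD, map_smul, LinearMap.smul_apply, smul_lie, smul_sub]
    rw [this, hξ.1, smul_zero]
  · have : d2 act ω (c • ξ) a b = c • d2 act ω ξ a b := by
      simp only [d2, map_smul, LinearMap.smul_apply, smul_lie, smul_sub, smul_add]
    rw [this, hξ.2, smul_zero]

theorem aux_hat (act : H →ₗ[k] V →ₗ[k] V) (ω : H →ₗ[k] H →ₗ[k] V) (p : V × H) :
    p ∈ hamHat act ω ↔ p.2 ∈ spSet act ω ∧ ∀ η, ω p.2 η = act η p.1 :=
  ⟨fun h => ⟨h.2.1.1, h.2.2⟩,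
   fun h => ⟨⟨p.2, ⟨h.1, _, h.2⟩, fun η => (h.2 η).symm⟩, ⟨h.1, _, h.2⟩, h.2⟩⟩

theorem aux_adm (act : H →ₗ[k] V →ₗ[k] V) (ω : H →ₗ[k] H →ₗ[k] V) (v : V) :
    v ∈ admSet act ω ↔ ∃ ξ ∈ spSet act ω, ∀ η, ω ξ η = act η v :=
  ⟨fun ⟨ξ, h, h'⟩ => ⟨ξ, h.1, fun η => (h' η).symm⟩,
   fun ⟨ξ, h, h'⟩ => ⟨ξ, ⟨h, v, h'⟩, fun η => (h' η).symm⟩⟩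

theorem aux_act (act : H →ₗ[k] V →ₗ[k] V)
    (hact : ∀ (ξ η : H) (v : V), act ⁅ξ, η⁆ v = act ξ (act η v) - act η (act ξ v))
    (ω : H →ₗ[k] H →ₗ[k] V) (ξ η : H) (hξ : ξ ∈ spSet act ω) (v : V)
    (hv : ∀ ζ, ω η ζ = act ζ v) (ζ : H) : ω ⁅ξ, η⁆ ζ = act ζ (act ξ v) := by
  have e := hξ.1 η ζ
  simp only [lieD, hv, hact] at e
  rw [← sub_eq_zero, ← neg_eq_zero, ← e]
  abel

end helpers

/-- (a) `V_ω ⋊_ω sp(𝔥,ω)` is a Lie algebra; (b) on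
`ĥam(𝔥,ω)` the semidirect bracket equals the central-extension bracket;
(c) `ĥam(𝔥,ω)` is a Lie subalgebra of both. -/
theorem statement8
    (act : H →ₗ[k] V →ₗ[k] V)
    (hact : ∀ (ξ η : H) (v : V), act ⁅ξ, η⁆ v = act ξ (act η v) - act η (act ξ v))
    (ω : H →ₗ[k] H →ₗ[k] V) (hωalt : ∀ ξ, ω ξ ξ = 0) :
    -- (a) Lie algebra structure on V_ω ⋊_ω sp(𝔥,ω)
    (∀ p q : V × H, p.1 ∈ admSet act ω → p.2 ∈ spSet act ω →
      q.1 ∈ admSet act ω → q.2 ∈ spSet act ω →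
      (brAb act ω p q).1 ∈ admSet act ω ∧ (brAb act ω p q).2 ∈ spSet act ω) ∧
    (∀ p q r : V × H, brAb act ω (p + q) r = brAb act ω p r + brAb act ω q r ∧
      brAb act ω r (p + q) = brAb act ω r p + brAb act ω r q) ∧
    (∀ (a : k) (p q : V × H), brAb act ω (a • p) q = a • brAb act ω p q ∧
      brAb act ω p (a • q) = a • brAb act ω p q) ∧
    (∀ p : V × H, brAb act ω p p = 0) ∧
    (∀ p q r : V × H, p.1 ∈ admSet act ω → p.2 ∈ spSet act ω →
      q.1 ∈ admSet act ω → q.2 ∈ spSet act ω →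
      r.1 ∈ admSet act ω → r.2 ∈ spSet act ω →
      brAb act ω (brAb act ω p q) r + brAb act ω (brAb act ω q r) p +
        brAb act ω (brAb act ω r p) q = 0) ∧
    -- (b) the two brackets agree on ĥam(𝔥,ω)
    (∀ p q : V × H, p ∈ hamHat act ω → q ∈ hamHat act ω →
      act p.2 q.1 = - act q.2 p.1 ∧ act p.2 q.1 = - ω p.2 q.2 ∧
      brAb act ω p q = brCen ω p q) ∧
    -- (c) ĥam(𝔥,ω) is a subalgebra for both brackets
    (∀ p q : V × H, p ∈ hamHat act ω → q ∈ hamHat act ω →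
      brAb act ω p q ∈ hamHat act ω ∧ brCen ω p q ∈ hamHat act ω) ∧
    (∀ p q : V × H, p ∈ hamHat act ω → q ∈ hamHat act ω →
      p + q ∈ hamHat act ω) ∧
    (∀ (a : k) (p : V × H), p ∈ hamHat act ω → a • p ∈ hamHat act ω) := by
  have skew := aux_skew ω hωalt
  have key : ∀ p q : V × H, p ∈ hamHat act ω → q ∈ hamHat act ω →
      act p.2 q.1 = - act q.2 p.1 ∧ act p.2 q.1 = - ω p.2 q.2 ∧
      brAb act ω p q = brCen ω p q := by
    intro p q hp hq
    have h1 : act p.2 q.1 = - ω p.2 q.2 := by rw [← hq.2.2, skew]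
    have h2 : act q.2 p.1 = ω p.2 q.2 := (hp.2.2 _).symm
    refine ⟨by rw [h1, h2], h1, ?_⟩
    simp only [brAb, brCen, h1, h2]
    congr 1
    abel
  refine ⟨?_, ?_, ?_, ?_, ?_, key, ?_, ?_, ?_⟩
  · intro p q hp1 hp2 hq1 hq2
    refine ⟨?_, aux_sp_lie act hact ω _ _ hp2 hq2⟩
    rw [aux_adm] at hp1 hq1 ⊢
    obtain ⟨x, hx, hx'⟩ := hp1
    obtain ⟨y, hy, hy'⟩ := hq1
    refine ⟨⁅p.2, y⁆ + (-1 : k) • (⁅q.2, x⁆ + ⁅p.2, q.2⁆), ?_, fun ζ => ?_⟩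
    · exact aux_sp_add _ _ _ _ (aux_sp_lie act hact ω _ _ hp2 hy)
        (aux_sp_smul _ _ _ _ (aux_sp_add _ _ _ _ (aux_sp_lie act hact ω _ _ hq2 hx)
          (aux_sp_lie act hact ω _ _ hp2 hq2)))
    · simp only [brAb, map_add, map_smul, LinearMap.add_apply, LinearMap.neg_apply,
        aux_act act hact ω _ _ hp2 _ hy', aux_act act hact ω _ _ hq2 _ hx',
        aux_omega act ω hωalt _ _ hp2 hq2, map_sub, map_neg, neg_smul, one_smul]
      abel
  · intro p q r
    constructor <;> ext <;>
      simp only [brAb, Prod.fst_add, Prod.snd_add, map_add, LinearMap.add_apply, add_lie, lie_add]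
    all_goals abel
  · intro a p q
    constructor <;> ext <;>
      simp only [brAb, Prod.smul_fst, Prod.smul_snd, map_smul, LinearMap.smul_apply, smul_lie,
        lie_smul, smul_add, smul_sub]
  · intro p
    ext <;> simp [brAb, hωalt]
  · intro p q r hp1 hp2 hq1 hq2 hr1 hr2
    have e := hp2.2 q.2 r.2
    simp only [d2] at e
    ext
    · simp only [brAb, Prod.fst_add, Prod.fst_zero, hact, map_add, map_sub]
      rw [← neg_eq_zero, ← e, skew r.2 p.2, ← lie_skew r.2 p.2]
      simp only [map_neg, LinearMap.neg_apply]
      abel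
    · simp only [brAb, Prod.snd_add, Prod.snd_zero]
      rw [← neg_eq_zero, ← lie_jacobi p.2 q.2 r.2, ← lie_skew ⁅p.2, q.2⁆, ← lie_skew ⁅q.2, r.2⁆,
        ← lie_skew ⁅r.2, p.2⁆]
      abel
  · intro p q hp hq
    rw [(key p q hp hq).2.2, and_self, aux_hat]
    exact ⟨aux_sp_lie act hact ω _ _ hp.2.1.1 hq.2.1.1,
      aux_omega act ω hωalt _ _ hp.2.1.1 hq.2.1.1⟩
  · intro p q hp hq
    rw [aux_hat] at hp hq ⊢
    exact ⟨aux_sp_add _ _ _ _ hp.1 hq.1, fun η => by simp [hp.2, hq.2]⟩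
  · intro a p hp
    rw [aux_hat] at hp ⊢
    exact ⟨aux_sp_smul _ _ _ _ hp.1, fun η => by simp [hp.2]⟩
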